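/- Let n ≥ 1 be an integer and let u : ℝⁿ → ℝ^ν be continuously differentiable. There is a constant C, depending only on n, such that for every x ∈ ℝⁿ and every r > 0, ‖u(x) − (1/|B(x,r)|) ∫_{B(x,r)} u(z) dz‖ ≤ C ∫_{B(x,r)} ‖Du(z)‖ · |x−z|^{1−n} dz, where Du(z) denotes the derivative of u at z and |B(x,r)| the Lebesgue measure of the ball B(x,r). -/

import Mathlib

open MeasureTheory Metric

open scoped ENNReal in
theorem riesz_polar {n : ℕ} (hn : 1 ≤ n) (f : EuclideanSpace ℝ (Fin n) → ℝ≥0∞) (hf : Measurable f)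
    (x : EuclideanSpace ℝ (Fin n)) (r : ℝ) :
    ∫⁻ z in ball x r, f z =
      ∫⁻ w, (∫⁻ s in Set.Ioo (0 : ℝ) r, ENNReal.ofReal (s ^ (n - 1)) * f (x + s • w.1))
        ∂(volume : Measure (EuclideanSpace ℝ (Fin n))).toSphere := by
  have : Nonempty (Fin n) := ⟨⟨0, hn⟩⟩
  let E := EuclideanSpace ℝ (Fin n)
  set g : E → ℝ≥0∞ := fun y => (ball x r).indicator f (x + y) with hg
  have hgm : Measurable g := (hf.indicator measurableSet_ball).comp (measurable_const_add x)
  have h1 : ∫⁻ z in ball x r, f z = ∫⁻ y, g y := by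
    rw [← lintegral_indicator measurableSet_ball, hg, lintegral_add_left_eq_self]
  have h2 : ∫⁻ y, g y = ∫⁻ y : ({(0 : E)}ᶜ : Set E), g y.1 ∂(volume.comap Subtype.val) := by
    rw [lintegral_subtype_comap (measurableSet_singleton _).compl, restrict_compl_singleton]
  have h3 : ∫⁻ y : ({(0 : E)}ᶜ : Set E), g y.1 ∂(volume.comap Subtype.val) =
      ∫⁻ p : sphere (0 : E) 1 × Set.Ioi (0 : ℝ), g (p.2.1 • p.1.1)
        ∂((volume : Measure E).toSphere.prod (.volumeIoiPow (n - 1))) := by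
    have hp := (volume : Measure E).measurePreserving_homeomorphUnitSphereProd
    have hd : Module.finrank ℝ E = n := by simp [E]
    rw [hd] at hp
    rw [← hp.lintegral_comp (by fun_prop)]
    refine lintegral_congr fun y => ?_
    congr 1
    have hy : ‖y.1‖ ≠ 0 := norm_ne_zero_iff.2 y.2
    simp [homeomorphUnitSphereProd, smul_smul, hy]
  rw [h1, h2, h3, lintegral_prod _ (by fun_prop)]
  refine lintegral_congr fun w => ?_
  have hw : ‖w.1‖ = 1 := by simp
  rw [Measure.volumeIoiPow, lintegral_withDensity_eq_lintegral_mul _ (by fun_prop) (by fun_prop)]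
  simp only [Pi.mul_apply]
  rw [lintegral_subtype_comap measurableSet_Ioi
    (fun s : ℝ => ENNReal.ofReal (s ^ (n - 1)) * g (s • w.1)),
    ← lintegral_indicator measurableSet_Ioi, ← lintegral_indicator measurableSet_Ioo]
  refine lintegral_congr fun s => ?_
  by_cases hs : 0 < s
  · by_cases hsr : s < r
    · simp [hs, hsr, hg, Set.indicator, norm_smul, hw, abs_of_pos hs]
    · simp [hs, hsr, hg, Set.indicator, norm_smul, hw, abs_of_pos hs]
  · simp [hs]

open scoped ENNReal in
theorem riesz_line {n ν : ℕ} (u : EuclideanSpace ℝ (Fin n) → EuclideanSpace ℝ (Fin ν))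
    (hu : ContDiff ℝ 1 u) (x w : EuclideanSpace ℝ (Fin n)) (hw : ‖w‖ = 1) (r s : ℝ) (hs : 0 < s)
    (hsr : s < r) :
    ‖u x - u (x + s • w)‖ₑ ≤ ∫⁻ t in Set.Ioo (0 : ℝ) r, ‖fderiv ℝ u (x + t • w)‖ₑ := by
  have hc : Continuous (fderiv ℝ u) := hu.continuous_fderiv (by norm_num)
  have hd : ∀ t : ℝ, HasDerivAt (fun t : ℝ => u (x + t • w)) (fderiv ℝ u (x + t • w) w) t := by
    intro t
    have h1 := ((hu.differentiable (by norm_num)) (x + t • w)).hasFDerivAt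
    have h2 : HasDerivAt (fun t : ℝ => x + t • w) w t := by
      simpa using ((hasDerivAt_id t).smul_const w).const_add x
    exact h1.comp_hasDerivAt t h2
  have hi := intervalIntegral.integral_eq_sub_of_hasDerivAt (a := 0) (b := s)
    (fun t _ => hd t) (Continuous.intervalIntegrable (by fun_prop) _ _)
  simp only [zero_smul, add_zero] at hi
  rw [← enorm_neg, neg_sub, ← hi, intervalIntegral.integral_of_le hs.le]
  refine (enorm_integral_le_lintegral_enorm _).trans ?_
  refine (lintegral_mono_set (t := Set.Ioo 0 r) fun t ht => ⟨ht.1, ht.2.trans_lt hsr⟩).trans ?_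
  refine lintegral_mono fun t => ?_
  rw [enorm_le_iff_norm_le]
  simpa [hw] using (fderiv ℝ u (x + t • w)).le_opNorm w

open scoped ENNReal in
theorem riesz_pow {n : ℕ} (hn : 1 ≤ n) (r : ℝ) (hr : 0 < r) :
    ∫⁻ s in Set.Ioo (0 : ℝ) r, ENNReal.ofReal (s ^ (n - 1)) = ENNReal.ofReal (r ^ n / n) := by
  rw [Measure.restrict_congr_set Ioo_ae_eq_Ioc,
    ← ofReal_integral_eq_lintegral_ofReal (intervalIntegral.intervalIntegrable_pow _).1,
    ← intervalIntegral.integral_of_le hr.le]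
  · obtain ⟨m, rfl⟩ : ∃ m, n = m + 1 := ⟨n - 1, by omega⟩
    simp
  · filter_upwards [ae_restrict_mem measurableSet_Ioc] with y hy
    exact pow_nonneg hy.1.le _

theorem riesz_integrable {n : ℕ} (hn : 1 ≤ n) (x : EuclideanSpace ℝ (Fin n)) (r : ℝ)
    (h : EuclideanSpace ℝ (Fin n) → ℝ) (hh : Continuous h) :
    IntegrableOn (fun z => h z * dist x z ^ ((1 : ℝ) - n)) (ball x r) := by
  have : Nonempty (Fin n) := ⟨⟨0, hn⟩⟩
  have h0 : IntegrableOn (fun y : EuclideanSpace ℝ (Fin n) => ‖y‖ ^ ((1 : ℝ) - n)) (ball 0 r) := by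
    rw [integrableOn_fun_norm_addHaar volume (f := fun t => t ^ ((1 : ℝ) - n))]
    have : IntegrableOn (fun _ : ℝ => (1 : ℝ)) (Set.Ioo 0 r) := by simp
    refine this.congr_fun (fun s hs => ?_) measurableSet_Ioo
    have hs0 : 0 < s := hs.1
    simp only [finrank_euclideanSpace, Fintype.card_fin, smul_eq_mul]
    rw [← Real.rpow_natCast, ← Real.rpow_add hs0]
    push_cast [Nat.cast_sub hn]
    simp
  have h1 : IntegrableOn (fun z => dist x z ^ ((1 : ℝ) - n)) (ball x r) := by
    rw [← integrable_indicator_iff measurableSet_ball] at h0 ⊢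
    have := h0.comp_sub_right x
    refine this.congr (.of_forall fun z => ?_)
    simp [Set.indicator, dist_eq_norm, norm_sub_rev]
  obtain ⟨M, hM⟩ := (isCompact_closedBall x r).exists_bound_of_continuousOn hh.continuousOn
  refine Integrable.bdd_mul h1 (c := M) hh.aestronglyMeasurable ?_
  filter_upwards [ae_restrict_mem measurableSet_ball] with z hz
  exact hM z (ball_subset_closedBall hz)

/-- (Riesz potential estimate.) For every `n ≥ 1` there is a constant `C = C(n)`
such that every continuously differentiable `u : ℝⁿ → ℝ^ν` satisfies, for all `x` and `r > 0`,
`‖u(x) − avg_{B(x,r)} u‖ ≤ C ∫_{B(x,r)} ‖Du(z)‖ · |x−z|^{1−n} dz`. -/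
theorem stmt_6 (n : ℕ) (hn : 1 ≤ n) :
    ∃ C : ℝ, 0 < C ∧
      ∀ (ν : ℕ) (u : EuclideanSpace ℝ (Fin n) → EuclideanSpace ℝ (Fin ν)),
        ContDiff ℝ 1 u →
      ∀ (x : EuclideanSpace ℝ (Fin n)) (r : ℝ), 0 < r →
        ‖u x - ((volume (ball x r)).toReal)⁻¹ • ∫ z in ball x r, u z‖
          ≤ C * ∫ z in ball x r, ‖fderiv ℝ u z‖ * dist x z ^ ((1 : ℝ) - n) := by
  have : Nonempty (Fin n) := ⟨⟨0, hn⟩⟩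
  set b := (volume (ball (0 : EuclideanSpace ℝ (Fin n)) 1)).toReal with hb
  have hbpos : 0 < b := ENNReal.toReal_pos (measure_ball_pos _ _ one_pos).ne' measure_ball_lt_top.ne
  have hn0 : (0 : ℝ) < n := by exact_mod_cast hn
  refine ⟨(n * b)⁻¹, by positivity, fun ν u hu x r hr => ?_⟩
  have hc : Continuous (fderiv ℝ u) := hu.continuous_fderiv (by norm_num)
  have hcu : Continuous u := hu.continuous
  have hV : (volume (ball x r)).toReal = r ^ n * b := by
    rw [Measure.addHaar_ball_of_pos _ _ hr, ENNReal.toReal_mul, hb, finrank_euclideanSpace,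
      Fintype.card_fin, ENNReal.toReal_ofReal (by positivity)]
  have hVpos : 0 < r ^ n * b := by positivity
  set I := ∫ z in ball x r, ‖fderiv ℝ u z‖ * dist x z ^ ((1 : ℝ) - n) with hI
  have hI0 : 0 ≤ I := integral_nonneg fun z => by positivity
  have hIe : ENNReal.ofReal I =
      ∫⁻ w, (∫⁻ s in Set.Ioo (0 : ℝ) r, ‖fderiv ℝ u (x + s • w.1)‖ₑ)
        ∂(volume : Measure (EuclideanSpace ℝ (Fin n))).toSphere := by
    rw [hI, ofReal_integral_eq_lintegral_ofReal (riesz_integrable hn x r _ hc.norm)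
      (.of_forall fun z => by positivity), riesz_polar hn _ (by fun_prop)]
    refine lintegral_congr fun w => setLIntegral_congr_fun measurableSet_Ioo fun s hs => ?_
    have hw : ‖w.1‖ = 1 := by simp
    have hs0 : 0 < s := hs.1
    have : dist x (x + s • w.1) = s := by simp [norm_smul, hw, abs_of_pos hs0]
    simp only [this]
    rw [← ENNReal.ofReal_mul (by positivity), ← ofReal_norm]
    congr 1
    rw [mul_left_comm, ← Real.rpow_natCast, ← Real.rpow_add hs0]
    push_cast [Nat.cast_sub hn]
    simp
  have hInt : IntegrableOn u (ball x r) :=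
    (hcu.continuousOn.integrableOn_compact (isCompact_closedBall x r)).mono_set
      ball_subset_closedBall
  have hdiff : u x - ((volume (ball x r)).toReal)⁻¹ • ∫ z in ball x r, u z =
      (r ^ n * b)⁻¹ • ∫ z in ball x r, (u x - u z) := by
    have hci : IntegrableOn (fun _ => u x) (ball x r) :=
      integrableOn_const measure_ball_lt_top.ne
    rw [integral_sub hci hInt, setIntegral_const,
      smul_sub, Measure.real, hV, smul_smul, inv_mul_cancel₀ hVpos.ne', one_smul]
  have key : ‖∫ z in ball x r, (u x - u z)‖ₑ ≤ ENNReal.ofReal (r ^ n / n * I) := by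
    refine (enorm_integral_le_lintegral_enorm _).trans ?_
    rw [riesz_polar hn _ (by fun_prop), ENNReal.ofReal_mul (by positivity), hIe,
      ← lintegral_const_mul' _ _ ENNReal.ofReal_ne_top]
    refine lintegral_mono fun w => ?_
    have hw : ‖w.1‖ = 1 := by simp
    rw [← riesz_pow hn r hr, ← lintegral_mul_const _ (by fun_prop)]
    refine setLIntegral_mono' measurableSet_Ioo fun s hs => ?_
    gcongr
    exact riesz_line u hu x w.1 hw r s hs.1 hs.2
  rw [← ofReal_norm, ENNReal.ofReal_le_ofReal_iff (by positivity)] at key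
  rw [hdiff, norm_smul, Real.norm_of_nonneg (by positivity)]
  calc (r ^ n * b)⁻¹ * _ ≤ (r ^ n * b)⁻¹ * (r ^ n / n * I) := by gcongr
    _ = (n * b)⁻¹ * I := by field_simp
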